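/- For every integer n ≥ 2, the n-th derivative of the implicit function at x₀ equals y^{(n)}(x₀) = Σ_{k=1}^{2n−1} Σ_{γ = (s_{p,t}) ∈ B_{n,k}} (−1)^k · n! · (k − s_{1,0} − 1)! / ∏_{p,t} (p! · t!)^{s_{p,t}} · [Σ_{(q_{p,t,j}) ∈ Z_γ} ∏_{p+t≥2} ∏_{j=0}^{t} binom(t, j)^{q_{p,t,j}} / q_{p,t,j}!] · [∏_{p,t} (f_{x^p y^t}(x₀, y₀))^{s_{p,t}}] / f_y(x₀, y₀)^k, where Z_γ is formed from the restriction (s_{p,t})_{p+t≥2} of γ together with its entry s_{1,0}. -/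

import Mathlib

open Filter Topology

/-- `pd f p r` is the mixed partial derivative `∂^(p+r) f / ∂x^p ∂y^r` of a function
of two real variables. -/
noncomputable def pd (f : ℝ → ℝ → ℝ) (p r : ℕ) : ℝ → ℝ → ℝ :=
  fun x y => iteratedDeriv p (fun x' => iteratedDeriv r (fun y' => f x' y') y) x

/-- `Delta f l g = Σ_{j=0}^{l} (−1)^j C(l,j) g_{x^{l−j} y^j} f_x^j f_y^{l−j}`. -/
noncomputable def Delta (f : ℝ → ℝ → ℝ) (l : ℕ) (g : ℝ → ℝ → ℝ) : ℝ → ℝ → ℝ :=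
  fun x y => ∑ j ∈ Finset.range (l + 1),
    (-1 : ℝ) ^ j * (l.choose j : ℝ) * pd g (l - j) j x y *
      (pd f 1 0 x y) ^ j * (pd f 0 1 x y) ^ (l - j)

/-- Membership in the set `B_n`. -/
def Bmem (n : ℕ) (s : (ℕ × ℕ) →₀ ℕ) : Prop :=
  s (0, 0) = 0 ∧ s (0, 1) = 0 ∧
  (s.sum fun p k => p.1 * k) = n ∧
  (s.sum fun p k => p.2 * k) + 1 = s.sum fun _ k => k

/-- Membership in the set `Z_γ`, formed from the entries `s_{p,t}` for `p + t ≥ 2`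
together with the entry `s_{1,0}`: families `(q_{p,t,j})` indexed by triples `(p, t, j)`
with `p + t ≥ 2` and `0 ≤ j ≤ t`, with `Σ_{j=0}^{t} q_{p,t,j} = s_{p,t}` for every such
`(p, t)` and `Σ j·q_{p,t,j} = s_{1,0}`. -/
def Zmem (s : (ℕ × ℕ) →₀ ℕ) (s10 : ℕ) (q : (ℕ × ℕ × ℕ) →₀ ℕ) : Prop :=
  (∀ v ∈ q.support, 2 ≤ v.1 + v.2.1 ∧ v.2.2 ≤ v.2.1) ∧
  (∀ p t : ℕ, 2 ≤ p + t → (∑ j ∈ Finset.range (t + 1), q (p, t, j)) = s (p, t)) ∧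
  (q.sum fun v k => v.2.2 * k) = s10

/-- `∏ c_i^{s_i} / s_i!`. -/
noncomputable def multiTerm {ι : Type*} (c : ι → ℝ) (s : ι →₀ ℕ) : ℝ :=
  s.prod fun i a => c i ^ a / (a.factorial : ℝ)

theorem multiTerm_add_single {ι : Type*} (c : ι → ℝ) (s : ι →₀ ℕ) (v : ι) :
    ((s v : ℝ) + 1) * multiTerm c (s + Finsupp.single v 1) = c v * multiTerm c s := by
  classical
  have hs : s.support ⊆ insert v s.support := Finset.subset_insert _ _
  have hs' : (s + Finsupp.single v 1).support ⊆ insert v s.support := by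
    intro i hi
    by_cases h : v = i
    · simp [h]
    · exact Finset.mem_insert_of_mem (by simpa [h, Finsupp.single_apply] using hi)
  rw [multiTerm, multiTerm, Finsupp.prod_of_support_subset _ hs _ (by simp),
    Finsupp.prod_of_support_subset _ hs' _ (by simp),
    ← Finset.mul_prod_erase _ _ (Finset.mem_insert_self v _),
    ← Finset.mul_prod_erase _ _ (Finset.mem_insert_self v _)]
  have h : ∀ i ∈ (insert v s.support).erase v,
      c i ^ (s + Finsupp.single v 1 : ι →₀ ℕ) i /
          (((s + Finsupp.single v 1 : ι →₀ ℕ) i).factorial : ℝ) =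
        c i ^ s i / ((s i).factorial : ℝ) := by
    intro i hi
    have hi' : v ≠ i := (Finset.ne_of_mem_erase hi).symm
    simp [hi']
  rw [Finset.prod_congr rfl h]
  simp only [Finsupp.add_apply, Finsupp.single_eq_same, Nat.factorial_succ, pow_succ]
  have := Nat.cast_ne_zero (R := ℝ).2 (Nat.factorial_ne_zero (s v))
  push_cast
  have h2 : (s v : ℝ) + 1 ≠ 0 := by positivity
  field_simp

theorem sum_multiTerm_shift {ι : Type*} [DecidableEq ι] (c : ι → ℝ) (T : Finset ι) (k : ℕ)
    (Φ : ι → (ι →₀ ℕ) → ℝ) :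
    ∑ v ∈ T, ∑ s ∈ T.finsuppAntidiag k, c v * multiTerm c s * Φ v (s + Finsupp.single v 1) =
      ∑ s ∈ T.finsuppAntidiag (k + 1), ∑ v ∈ T, (s v : ℝ) * multiTerm c s * Φ v s := by
  rw [Finset.sum_comm (s := T.finsuppAntidiag (k + 1))]
  refine Finset.sum_congr rfl fun v hv => ?_
  refine Finset.sum_bij_ne_zero (fun s _ _ => s + Finsupp.single v 1) ?_ ?_ ?_ ?_
  · intro s hs _
    rw [Finset.mem_finsuppAntidiag] at hs ⊢
    refine ⟨?_, ?_⟩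
    · simp [Finset.sum_add_distrib, hs.1, Finsupp.single_apply, hv]
    · refine Finsupp.support_add.trans (Finset.union_subset hs.2 ?_)
      exact Finsupp.support_single_subset.trans (by simpa using hv)
  · intro a _ _ b _ _ h
    exact add_right_cancel h
  · intro s hs h0
    have hsv : s v ≠ 0 := by
      rintro h
      simp [h] at h0
    have hle : Finsupp.single v 1 ≤ s := by
      simpa using Nat.one_le_iff_ne_zero.2 hsv
    have hs' : s - Finsupp.single v 1 + Finsupp.single v 1 = s := tsub_add_cancel_of_le hle
    refine ⟨s - Finsupp.single v 1, ?_, ?_, hs'⟩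
    · rw [Finset.mem_finsuppAntidiag] at hs ⊢
      refine ⟨?_, (Finsupp.support_mono tsub_le_self).trans hs.2⟩
      have := hs.1
      rw [← hs'] at this
      simpa [Finset.sum_add_distrib, Finsupp.single_apply, hv] using this
    · rw [← multiTerm_add_single, hs']
      convert h0 using 3
      have := DFunLike.congr_fun hs' v
      simp only [Finsupp.add_apply, Finsupp.single_eq_same] at this
      exact_mod_cast this
  · intro s _ _
    rw [← multiTerm_add_single]
    simp

/-- The part of the `k`-th power of `∑ c_{p,t} X^p Z^t`, divided by `k!`, in degree `n` in `X` and
`k - m` in `Z`. -/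
noncomputable def powCoeff (c : ℕ × ℕ → ℝ) (T : Finset (ℕ × ℕ)) (k m n : ℕ) : ℝ :=
  ∑ s ∈ T.finsuppAntidiag k,
    if (s.sum fun v a => v.1 * a) = n ∧ (s.sum fun v a => v.2 * a) + m = k
    then multiTerm c s else 0

theorem sum_weight_mul {ι : Type*} (T : Finset ι) (ω : ι → ℕ) (s : ι →₀ ℕ)
    (hs : s.support ⊆ T) :
    (s.sum fun v a => ω v * a) = ∑ v ∈ T, ω v * s v :=
  Finsupp.sum_of_support_subset _ hs _ (by simp)

theorem sum_weight_add_single {ι : Type*} (ω : ι → ℕ) (s : ι →₀ ℕ) (v : ι) :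
    ((s + Finsupp.single v 1).sum fun v a => ω v * a) = (s.sum fun v a => ω v * a) + ω v := by
  classical
  rw [Finsupp.sum_add_index' (by simp) (by intros; ring), Finsupp.sum_single_index (by simp)]
  simp

theorem sum_weight_mul_powCoeff (c : ℕ × ℕ → ℝ) (T : Finset (ℕ × ℕ)) (k m n : ℕ) (α β : ℝ) :
    ∑ v ∈ T, (if v.1 ≤ n then
        (α + β * v.2) * c v * powCoeff c T k (m + v.2) (n - v.1) else 0) =
      (α * (k + 1) + β * (k - m)) * powCoeff c T (k + 1) (m + 1) n := by
  classical
  have key := sum_multiTerm_shift c T k fun v s => (α + β * v.2) *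
    if (s.sum fun v a => v.1 * a) = n ∧ (s.sum fun v a => v.2 * a) + (m + 1) = k + 1
    then 1 else 0
  refine Eq.trans ?_ (key.trans ?_)
  · refine Finset.sum_congr rfl fun v _ => ?_
    rw [powCoeff, Finset.mul_sum]
    split_ifs with hv
    · refine Finset.sum_congr rfl fun s _ => ?_
      have hiff : ((s.sum fun v a => v.1 * a) = n - v.1 ∧
          (s.sum fun v a => v.2 * a) + (m + v.2) = k) ↔
          (((s + Finsupp.single v 1).sum fun v a => v.1 * a) = n ∧
          ((s + Finsupp.single v 1).sum fun v a => v.2 * a) + (m + 1) = k + 1) := by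
        rw [sum_weight_add_single Prod.fst, sum_weight_add_single Prod.snd]
        omega
      simp only [hiff]
      split_ifs <;> ring
    · refine (Finset.sum_eq_zero fun s _ => ?_).symm
      rw [if_neg, mul_zero, mul_zero]
      rw [sum_weight_add_single Prod.fst]
      omega
  · rw [powCoeff, Finset.mul_sum]
    refine Finset.sum_congr rfl fun s hs => ?_
    rw [Finset.mem_finsuppAntidiag] at hs
    split_ifs with h
    · have h1 : ∑ v ∈ T, ((s v : ℕ) : ℝ) = k + 1 := by exact_mod_cast hs.1
      have h2 : ∑ v ∈ T, (v.2 : ℝ) * s v = k - m := by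
        have := h.2
        rw [sum_weight_mul T Prod.snd s hs.2] at this
        rw [eq_sub_iff_add_eq]
        have h3 : (∑ v ∈ T, v.2 * s v) + m = k := by omega
        exact_mod_cast h3
      rw [← h1, ← h2, Finset.mul_sum, Finset.mul_sum, ← Finset.sum_add_distrib, Finset.sum_mul]
      exact Finset.sum_congr rfl fun v _ => by ring
    · simp

theorem powCoeff_eq_zero (c : ℕ × ℕ → ℝ) {T : Finset (ℕ × ℕ)} (hT : ∀ v ∈ T, 2 ≤ 2 * v.1 + v.2)
    {k m n : ℕ} (h : k < m ∨ 2 * n < k + m) : powCoeff c T k m n = 0 := by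
  refine Finset.sum_eq_zero fun s hs => if_neg ?_
  rw [Finset.mem_finsuppAntidiag] at hs
  rintro ⟨h1, h2⟩
  rw [sum_weight_mul T Prod.fst s hs.2] at h1
  rw [sum_weight_mul T Prod.snd s hs.2] at h2
  have h3 : ∑ v ∈ T, 2 * s v ≤ ∑ v ∈ T, (2 * (v.1 * s v) + v.2 * s v) :=
    Finset.sum_le_sum fun v hv => by nlinarith [Nat.mul_le_mul_right (s v) (hT v hv)]
  rw [Finset.sum_add_distrib, ← Finset.mul_sum, ← Finset.mul_sum, hs.1] at h3
  omega

theorem powCoeff_zero (c : ℕ × ℕ → ℝ) (T : Finset (ℕ × ℕ)) (m n : ℕ) :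
    powCoeff c T 0 m n = if m = 0 ∧ n = 0 then 1 else 0 := by
  simp [powCoeff, multiTerm, and_comm, eq_comm]

/-- The coefficient of `X ^ n` in the `m`-th power of the solution of `Y = ∑ c_{p,t} X^p Y^t`,
as given by Lagrange inversion. -/
noncomputable def lagrangeCoeff (c : ℕ × ℕ → ℝ) (T : Finset (ℕ × ℕ)) (N m n : ℕ) : ℝ :=
  powCoeff c T 0 m n +
    ∑ k ∈ Finset.range (2 * N), (m : ℝ) * (k.factorial : ℝ) * powCoeff c T (k + 1) m n

theorem lagrangeCoeff_succ (c : ℕ × ℕ → ℝ) {T : Finset (ℕ × ℕ)}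
    (hT : ∀ v ∈ T, 2 ≤ 2 * v.1 + v.2) {N n : ℕ} (hn : n ≤ N) (m : ℕ) :
    lagrangeCoeff c T N (m + 1) n =
      ∑ v ∈ T, if v.1 ≤ n then c v * lagrangeCoeff c T N (m + v.2) (n - v.1) else 0 := by
  have h1 := sum_weight_mul_powCoeff c T 0 m n 1 0
  have h2 := fun k : ℕ => sum_weight_mul_powCoeff c T (k + 1) m n m 1
  have hsplit : (∑ v ∈ T, if v.1 ≤ n then c v * lagrangeCoeff c T N (m + v.2) (n - v.1) else 0) =
      powCoeff c T 1 (m + 1) n + ∑ k ∈ Finset.range (2 * N),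
        (m + 1 : ℝ) * ((k + 1).factorial : ℝ) * powCoeff c T (k + 2) (m + 1) n := by
    have h1' : powCoeff c T 1 (m + 1) n =
        ∑ v ∈ T, if v.1 ≤ n then c v * powCoeff c T 0 (m + v.2) (n - v.1) else 0 := by
      simpa using h1.symm
    have h2' : ∀ k : ℕ, (m + 1 : ℝ) * ((k + 1).factorial : ℝ) * powCoeff c T (k + 2) (m + 1) n =
        ∑ v ∈ T, if v.1 ≤ n then c v * (((m + v.2 : ℕ) : ℝ) * (k.factorial : ℝ) *
          powCoeff c T (k + 1) (m + v.2) (n - v.1)) else 0 := by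
      intro k
      have : (m + 1 : ℝ) * ((k + 1).factorial : ℝ) * powCoeff c T (k + 2) (m + 1) n =
          (k.factorial : ℝ) * ((m * (((k + 1 : ℕ) : ℝ) + 1) + 1 * (((k + 1 : ℕ) : ℝ) - m)) *
            powCoeff c T (k + 1 + 1) (m + 1) n) := by
        rw [Nat.factorial_succ]; push_cast; ring
      rw [this, ← h2 k, Finset.mul_sum]
      refine Finset.sum_congr rfl fun v _ => ?_
      split_ifs
      · push_cast; ring
      · ring
    rw [h1', Finset.sum_congr rfl fun k _ => h2' k, Finset.sum_comm, ← Finset.sum_add_distrib]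
    refine Finset.sum_congr rfl fun v _ => ?_
    split_ifs
    · rw [lagrangeCoeff, mul_add, Finset.mul_sum]
    · simp
  have htop : powCoeff c T (2 * N + 1) (m + 1) n = 0 := powCoeff_eq_zero c hT (by omega)
  have hbot : (m : ℝ) * powCoeff c T 1 (m + 1) n = 0 := by
    rcases Nat.eq_zero_or_pos m with rfl | hm
    · simp
    · rw [powCoeff_eq_zero c hT (by omega), mul_zero]
  have hext : (∑ k ∈ Finset.range (2 * N), ((m + 1 : ℕ) : ℝ) * (k.factorial : ℝ) *
      powCoeff c T (k + 1) (m + 1) n) = ∑ k ∈ Finset.range (2 * N + 1),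
        ((m + 1 : ℕ) : ℝ) * (k.factorial : ℝ) * powCoeff c T (k + 1) (m + 1) n := by
    rw [Finset.sum_range_succ, htop, mul_zero, add_zero]
  rw [hsplit, lagrangeCoeff, hext, Finset.sum_range_succ', powCoeff_eq_zero c hT (by omega)]
  push_cast
  simp only [Nat.factorial_zero, Nat.cast_one, mul_one, zero_add]
  simp only [add_assoc, Nat.reduceAdd]
  linear_combination hbot

theorem eq_lagrangeCoeff (c : ℕ × ℕ → ℝ) {T : Finset (ℕ × ℕ)}
    (hT : ∀ v ∈ T, 2 ≤ 2 * v.1 + v.2) {N : ℕ} {y : ℕ → ℕ → ℝ}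
    (h0 : ∀ n, y 0 n = if n = 0 then 1 else 0) (hlt : ∀ m n, n < m → y m n = 0)
    (hrec : ∀ m n, n ≤ N → y (m + 1) n =
      ∑ v ∈ T, if v.1 ≤ n then c v * y (m + v.2) (n - v.1) else 0)
    (m n : ℕ) (hn : n ≤ N) : y m n = lagrangeCoeff c T N m n := by
  induction h : 2 * n - m using Nat.strong_induction_on generalizing m n with
  | _ d ih =>
  rcases lt_or_ge n m with hnm | hnm
  · rw [hlt m n hnm, lagrangeCoeff, powCoeff_eq_zero c hT (by omega), zero_add]
    exact (Finset.sum_eq_zero fun k _ => by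
      rw [powCoeff_eq_zero c hT (by omega), mul_zero]).symm
  · cases m with
    | zero => simp [h0, lagrangeCoeff, powCoeff_zero]
    | succ m =>
      rw [hrec m n hn, lagrangeCoeff_succ c hT hn]
      refine Finset.sum_congr rfl fun v hv => ?_
      have := hT v hv
      split_ifs with hvn
      · rw [ih (2 * (n - v.1) - (m + v.2)) (by omega) _ _ (by omega) rfl]
      · rfl

/-- The triples `(p, t, j)` with `(p, t) ∈ S` and `j ≤ t`. -/
def triples (S : Finset (ℕ × ℕ)) : Finset (ℕ × ℕ × ℕ) :=
  S.biUnion fun i => (Finset.range (i.2 + 1)).image fun j => (i.1, i.2, j)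

theorem mem_triples {S : Finset (ℕ × ℕ)} {v : ℕ × ℕ × ℕ} :
    v ∈ triples S ↔ (v.1, v.2.1) ∈ S ∧ v.2.2 ≤ v.2.1 := by
  obtain ⟨p, t, j⟩ := v
  simp only [triples, Finset.mem_biUnion, Finset.mem_image, Finset.mem_range, Prod.mk.injEq]
  constructor
  · rintro ⟨⟨a, b⟩, h, x, hx, rfl, rfl, rfl⟩
    exact ⟨h, by simpa [Nat.lt_succ_iff] using hx⟩
  · rintro ⟨h, hj⟩
    exact ⟨(p, t), h, j, by simpa [Nat.lt_succ_iff] using hj, rfl, rfl, rfl⟩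

theorem sum_triples_row {M : Type*} [AddCommMonoid M] {S : Finset (ℕ × ℕ)} {i : ℕ × ℕ}
    (hi : i ∈ S) (g : ℕ × ℕ × ℕ → M) :
    (∑ v ∈ triples S, if (v.1, v.2.1) = i then g v else 0) =
      ∑ j ∈ Finset.range (i.2 + 1), g (i.1, i.2, j) := by
  rw [← Finset.sum_filter]
  symm
  refine Finset.sum_bij (fun j _ => (i.1, i.2, j)) ?_ ?_ ?_ ?_
  · intro j hj
    simpa [mem_triples, hi, Nat.lt_succ_iff] using hj
  · intro a _ b _ h
    simpa using h
  · rintro ⟨p, t, j⟩ hv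
    rw [Finset.mem_filter, mem_triples] at hv
    obtain ⟨⟨_, hj⟩, rfl⟩ := hv
    exact ⟨j, by simpa [Nat.lt_succ_iff] using hj, rfl⟩
  · intros; rfl

theorem zmem_add_single {s : (ℕ × ℕ) →₀ ℕ} {r : ℕ} {q : (ℕ × ℕ × ℕ) →₀ ℕ} {v : ℕ × ℕ × ℕ}
    (hv : 2 ≤ v.1 + v.2.1 ∧ v.2.2 ≤ v.2.1) :
    Zmem (s + Finsupp.single (v.1, v.2.1) 1) r (q + Finsupp.single v 1) ↔
      v.2.2 ≤ r ∧ Zmem s (r - v.2.2) q := by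
  classical
  obtain ⟨p, t, j⟩ := v
  have h1 : (∀ w ∈ (q + Finsupp.single (p, t, j) 1).support, 2 ≤ w.1 + w.2.1 ∧ w.2.2 ≤ w.2.1) ↔
      ∀ w ∈ q.support, 2 ≤ w.1 + w.2.1 ∧ w.2.2 ≤ w.2.1 := by
    refine ⟨fun h w hw => h w ?_, fun h w hw => ?_⟩
    · simp only [Finsupp.mem_support_iff, Finsupp.add_apply] at hw ⊢
      omega
    · rcases Finset.mem_union.1 (Finsupp.support_add hw) with hw | hw
      · exact h w hw
      · rw [Finset.mem_singleton.1 (Finsupp.support_single_subset hw)]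
        exact hv
  have h2 : ∀ p' t' : ℕ,
      (∑ x ∈ Finset.range (t' + 1), (q + Finsupp.single (p, t, j) 1 : ℕ × ℕ × ℕ →₀ ℕ) (p', t', x)) =
      (∑ x ∈ Finset.range (t' + 1), q (p', t', x)) + Finsupp.single (p, t) 1 (p', t') := by
    intro p' t'
    simp only [Finsupp.add_apply, Finset.sum_add_distrib]
    congr 1
    by_cases h : (p, t) = (p', t')
    · obtain ⟨rfl, rfl⟩ := Prod.mk.inj h
      have : j < t + 1 := Nat.lt_succ_of_le hv.2
      simp [Finsupp.single_apply, this]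
    · rw [Finsupp.single_eq_of_ne (Ne.symm h)]
      refine Finset.sum_eq_zero fun x _ => Finsupp.single_eq_of_ne fun h' => h ?_
      simp only [Prod.mk.injEq] at h' ⊢
      exact ⟨h'.1.symm, h'.2.1.symm⟩
  simp only [Zmem, h1, h2, sum_weight_add_single (fun w : ℕ × ℕ × ℕ => w.2.2)]
  simp only [Finsupp.add_apply, add_left_inj]
  constructor
  · rintro ⟨a, b, e⟩
    exact ⟨by omega, a, b, by omega⟩
  · rintro ⟨d, a, b, e⟩
    exact ⟨a, b, by omega⟩

theorem sum_range_choose_mul_choose (t τ r : ℕ) :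
    (∑ j ∈ Finset.range (t + 1), if j ≤ r then (t.choose j) * (τ.choose (r - j)) else 0) =
      (τ + t).choose r := by
  rw [add_comm τ t, Nat.add_choose_eq, Finset.Nat.sum_antidiagonal_eq_sum_range_succ_mk,
    ← Finset.sum_filter]
  refine Finset.sum_subset (fun j hj => ?_) fun j hj hj' => ?_
  · simp only [Finset.mem_filter, Finset.mem_range] at hj ⊢
    omega
  · simp only [Finset.mem_filter, Finset.mem_range] at hj hj'
    rw [Nat.choose_eq_zero_of_lt (by omega), zero_mul]

open Classical in
theorem sum_zmem_multiTerm {S : Finset (ℕ × ℕ)} (hS : ∀ i ∈ S, 2 ≤ i.1 + i.2) (k : ℕ)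
    (s : (ℕ × ℕ) →₀ ℕ) (hs : s ∈ S.finsuppAntidiag k) (r : ℕ) :
    (∑ q ∈ (triples S).finsuppAntidiag k, if Zmem s r q then
      multiTerm (fun v : ℕ × ℕ × ℕ => (v.2.1.choose v.2.2 : ℝ)) q else 0) =
      ((s.sum fun v a => v.2 * a).choose r : ℝ) * multiTerm (fun _ => 1) s := by
  induction k generalizing s r with
  | zero =>
    have h0 : s = 0 := by simpa using hs
    subst h0
    cases r <;> simp [Zmem, multiTerm]
  | succ k ih =>
    rw [Finset.mem_finsuppAntidiag] at hs
    obtain ⟨i, hi, hsi⟩ : ∃ i ∈ S, s i ≠ 0 := by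
      by_contra! h
      simp [Finset.sum_eq_zero h] at hs
    obtain ⟨s₀, rfl⟩ : ∃ s₀, s = s₀ + Finsupp.single i 1 :=
      ⟨s - Finsupp.single i 1, (tsub_add_cancel_of_le
        (by simpa using Nat.one_le_iff_ne_zero.2 hsi)).symm⟩
    have hs₀ : s₀ ∈ S.finsuppAntidiag k := by
      rw [Finset.mem_finsuppAntidiag]
      refine ⟨by simpa [Finset.sum_add_distrib, Finsupp.single_apply, hi] using hs.1, ?_⟩
      exact (Finsupp.support_mono le_self_add).trans hs.2
    have key := sum_multiTerm_shift (fun v : ℕ × ℕ × ℕ => (v.2.1.choose v.2.2 : ℝ)) (triples S) k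
      fun v q => if (v.1, v.2.1) = i then
        if Zmem (s₀ + Finsupp.single i 1) r q then 1 else 0 else 0
    set M := multiTerm (fun v : ℕ × ℕ × ℕ => (v.2.1.choose v.2.2 : ℝ)) with hM
    have hright : (∑ q ∈ (triples S).finsuppAntidiag (k + 1), ∑ v ∈ triples S,
        (q v : ℝ) * M q * if (v.1, v.2.1) = i then
          if Zmem (s₀ + Finsupp.single i 1) r q then (1 : ℝ) else 0 else 0) =
        ((s₀ i : ℝ) + 1) * ∑ q ∈ (triples S).finsuppAntidiag (k + 1),
          if Zmem (s₀ + Finsupp.single i 1) r q then M q else 0 := by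
      rw [Finset.mul_sum]
      refine Finset.sum_congr rfl fun q _ => ?_
      simp only [mul_ite, mul_zero]
      rw [sum_triples_row hi]
      split_ifs with hq
      · have := hq.2.1 i.1 i.2 (hS i hi)
        simp only [mul_one]
        rw [← Finset.sum_mul]
        congr 1
        simp only [Prod.mk.eta, Finsupp.add_apply, Finsupp.single_eq_same] at this
        exact_mod_cast this
      · simp
    have hleft : (∑ v ∈ triples S, ∑ q ∈ (triples S).finsuppAntidiag k,
        (v.2.1.choose v.2.2 : ℝ) * M q * if (v.1, v.2.1) = i then
          if Zmem (s₀ + Finsupp.single i 1) r (q + Finsupp.single v 1) then (1 : ℝ) else 0 else 0) =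
        (((s₀.sum fun v a => v.2 * a) + i.2).choose r : ℝ) * multiTerm (fun _ => 1) s₀ := by
      have : ∀ v ∈ triples S, (∑ q ∈ (triples S).finsuppAntidiag k,
        (v.2.1.choose v.2.2 : ℝ) * M q * if (v.1, v.2.1) = i then
          if Zmem (s₀ + Finsupp.single i 1) r (q + Finsupp.single v 1) then (1 : ℝ) else 0 else 0) =
        if (v.1, v.2.1) = i then (((if v.2.2 ≤ r then v.2.1.choose v.2.2 *
          (s₀.sum fun v a => v.2 * a).choose (r - v.2.2) else 0 : ℕ) : ℝ) *
            multiTerm (fun _ => 1) s₀) else 0 := by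
        intro v hv
        rw [mem_triples] at hv
        split_ifs with h hr
        · subst h
          simp only [zmem_add_single ⟨hS _ hv.1, hv.2⟩, hr, true_and]
          push_cast
          rw [mul_assoc, ← ih s₀ hs₀ (r - v.2.2), Finset.mul_sum]
          exact Finset.sum_congr rfl fun q _ => by split_ifs <;> simp
        · subst h
          simp [zmem_add_single ⟨hS _ hv.1, hv.2⟩, hr]
        · simp
      rw [Finset.sum_congr rfl this, sum_triples_row hi, ← Finset.sum_mul]
      congr 1
      rw [← Nat.cast_sum, sum_range_choose_mul_choose]
    have hms := multiTerm_add_single (fun _ : ℕ × ℕ => (1 : ℝ)) s₀ i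
    have hne : (s₀ i : ℝ) + 1 ≠ 0 := by positivity
    refine mul_left_cancel₀ hne ?_
    rw [← hright, ← key, hleft, sum_weight_add_single Prod.snd]
    linear_combination -(((s₀.sum fun v a => v.2 * a) + i.2).choose r : ℝ) * hms

theorem finsum_zmem {s : (ℕ × ℕ) →₀ ℕ} (hs : ∀ i ∈ s.support, 2 ≤ i.1 + i.2) (r : ℕ) :
    (∑ᶠ q ∈ {q : (ℕ × ℕ × ℕ) →₀ ℕ | Zmem s r q},
      q.prod fun v c => (v.2.1.choose v.2.2 : ℝ) ^ c / (c.factorial : ℝ)) =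
      ((s.sum fun v a => v.2 * a).choose r : ℝ) * multiTerm (fun _ => 1) s := by
  classical
  set k := ∑ i ∈ s.support, s i with hk
  rw [← sum_zmem_multiTerm hs k s (by simp [hk]) r, ← Finset.sum_filter,
    ← finsum_mem_coe_finset]
  refine finsum_mem_congr ?_ fun q _ => rfl
  ext q
  simp only [Set.mem_ofPred_eq, Finset.coe_filter, Finset.mem_finsuppAntidiag]
  refine ⟨fun h => ⟨⟨?_, fun v hv => ?_⟩, h⟩, fun h => h.2⟩
  · rw [triples, Finset.sum_biUnion]
    · refine Finset.sum_congr rfl fun i hi => ?_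
      rw [Finset.sum_image (by intro a _ b _ hab; simpa using hab)]
      exact h.2.1 i.1 i.2 (hs i hi)
    · intro a _ b _ hab
      refine Finset.disjoint_left.2 fun v hv hv' => hab ?_
      simp only [Finset.mem_image] at hv hv'
      obtain ⟨_, _, rfl⟩ := hv
      obtain ⟨_, _, h'⟩ := hv'
      simp only [Prod.mk.injEq] at h'
      exact Prod.ext h'.1.symm h'.2.1.symm
  · obtain ⟨h1, h2⟩ := h.1 v hv
    refine mem_triples.2 ⟨?_, h2⟩
    rw [Finsupp.mem_support_iff, ← h.2.1 v.1 v.2.1 h1]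
    intro h0
    rw [Finset.sum_eq_zero_iff] at h0
    exact Finsupp.mem_support_iff.1 hv (h0 v.2.2 (by simpa [Nat.lt_succ_iff] using h2))

/-- The derivative of `g` in the direction `w`, as a function of the base point. -/
noncomputable def dirDeriv (w : ℝ × ℝ) (g : ℝ × ℝ → ℝ) : ℝ × ℝ → ℝ :=
  fun P => fderiv ℝ g P w

theorem dirDeriv_contDiffOn {U : Set (ℝ × ℝ)} (hU : IsOpen U) (w : ℝ × ℝ) {g : ℝ × ℝ → ℝ}
    (hg : ContDiffOn ℝ (⊤ : ℕ∞) g U) : ContDiffOn ℝ (⊤ : ℕ∞) (dirDeriv w g) U :=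
  (hg.fderiv_of_isOpen hU (m := ((⊤ : ℕ∞) : WithTop ℕ∞)) (by simp)).clm_apply contDiffOn_const

theorem dirDeriv_iterate_contDiffOn {U : Set (ℝ × ℝ)} (hU : IsOpen U) (w : ℝ × ℝ)
    {g : ℝ × ℝ → ℝ} (hg : ContDiffOn ℝ (⊤ : ℕ∞) g U) (r : ℕ) :
    ContDiffOn ℝ (⊤ : ℕ∞) ((dirDeriv w)^[r] g) U := by
  induction r generalizing g with
  | zero => exact hg
  | succ r ih => exact ih (dirDeriv_contDiffOn hU w hg)

theorem dirDeriv_congr {U : Set (ℝ × ℝ)} (hU : IsOpen U) (w : ℝ × ℝ) {g h : ℝ × ℝ → ℝ}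
    (hgh : Set.EqOn g h U) : Set.EqOn (dirDeriv w g) (dirDeriv w h) U := fun P hP => by
  rw [dirDeriv, dirDeriv, (hgh.eventuallyEq_of_mem (hU.mem_nhds hP)).fderiv_eq]

theorem dirDeriv_iterate_congr {U : Set (ℝ × ℝ)} (hU : IsOpen U) (w : ℝ × ℝ) {g h : ℝ × ℝ → ℝ}
    (hgh : Set.EqOn g h U) (r : ℕ) :
    Set.EqOn ((dirDeriv w)^[r] g) ((dirDeriv w)^[r] h) U := by
  induction r generalizing g h with
  | zero => exact hgh
  | succ r ih => exact ih (dirDeriv_congr hU w hgh)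

theorem ContDiffOn.differentiableAt_of_isOpen {U : Set (ℝ × ℝ)} (hU : IsOpen U) {g : ℝ × ℝ → ℝ}
    (hg : ContDiffOn ℝ (⊤ : ℕ∞) g U) {P : ℝ × ℝ} (hP : P ∈ U) : DifferentiableAt ℝ g P :=
  (hg.contDiffAt (hU.mem_nhds hP)).differentiableAt (by simp)

theorem dirDeriv_comm {U : Set (ℝ × ℝ)} (hU : IsOpen U) (v w : ℝ × ℝ) {g : ℝ × ℝ → ℝ}
    (hg : ContDiffOn ℝ (⊤ : ℕ∞) g U) :
    Set.EqOn (dirDeriv v (dirDeriv w g)) (dirDeriv w (dirDeriv v g)) U := by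
  intro P hP
  have hd : DifferentiableAt ℝ (fderiv ℝ g) P :=
    ((hg.fderiv_of_isOpen hU (m := ((⊤ : ℕ∞) : WithTop ℕ∞)) (by simp)).contDiffAt
      (hU.mem_nhds hP)).differentiableAt (by simp)
  have h : ∀ a b : ℝ × ℝ, dirDeriv a (dirDeriv b g) P = fderiv ℝ (fderiv ℝ g) P a b := by
    intro a b
    change fderiv ℝ (fun Q => fderiv ℝ g Q b) P a = _
    rw [fderiv_clm_apply hd (differentiableAt_const _)]
    simp
  have h2 : (2 : WithTop ℕ∞) ≤ ((⊤ : ℕ∞) : WithTop ℕ∞) :=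
    WithTop.coe_le_coe.2 (le_top : (2 : ℕ∞) ≤ ⊤)
  rw [h, h]
  exact ((hg.contDiffAt (hU.mem_nhds hP)).isSymmSndFDerivAt (by simpa using h2)).eq v w

theorem dirDeriv_iterate_comm {U : Set (ℝ × ℝ)} (hU : IsOpen U) (v w : ℝ × ℝ) {g : ℝ × ℝ → ℝ}
    (hg : ContDiffOn ℝ (⊤ : ℕ∞) g U) (r : ℕ) :
    Set.EqOn ((dirDeriv v)^[r] (dirDeriv w g)) (dirDeriv w ((dirDeriv v)^[r] g)) U := by
  induction r generalizing g with
  | zero => exact fun _ _ => rfl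
  | succ r ih =>
    exact (dirDeriv_iterate_congr hU v (dirDeriv_comm hU v w hg) r).trans
      (ih (dirDeriv_contDiffOn hU v hg))

theorem dirDeriv_iterate_sub {U : Set (ℝ × ℝ)} (hU : IsOpen U) (w : ℝ × ℝ) {g h : ℝ × ℝ → ℝ}
    (hg : ContDiffOn ℝ (⊤ : ℕ∞) g U) (hh : ContDiffOn ℝ (⊤ : ℕ∞) h U) (r : ℕ) :
    Set.EqOn ((dirDeriv w)^[r] (g - h)) ((dirDeriv w)^[r] g - (dirDeriv w)^[r] h) U := by
  induction r generalizing g h with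
  | zero => exact fun _ _ => rfl
  | succ r ih =>
    refine Set.EqOn.trans (dirDeriv_iterate_congr hU w (fun P hP => ?_) r)
      (ih (dirDeriv_contDiffOn hU w hg) (dirDeriv_contDiffOn hU w hh))
    simp [dirDeriv, fderiv_sub (hg.differentiableAt_of_isOpen hU hP)
      (hh.differentiableAt_of_isOpen hU hP)]

/-- The mixed partial derivative `∂^(p+r) g / ∂x^p ∂y^r`, through Fréchet derivatives. -/
noncomputable def mixedDeriv (p r : ℕ) (g : ℝ × ℝ → ℝ) : ℝ × ℝ → ℝ :=
  (dirDeriv (1, 0))^[p] ((dirDeriv (0, 1))^[r] g)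

theorem iteratedDeriv_fst {U : Set (ℝ × ℝ)} (hU : IsOpen U) {g : ℝ × ℝ → ℝ}
    (hg : ContDiffOn ℝ (⊤ : ℕ∞) g U) (p : ℕ) {x y : ℝ} (h : (x, y) ∈ U) :
    iteratedDeriv p (fun x' => g (x', y)) x = (dirDeriv (1, 0))^[p] g (x, y) := by
  induction p generalizing g x with
  | zero => simp
  | succ p ih =>
    rw [iteratedDeriv_succ', Function.iterate_succ_apply, ← ih (dirDeriv_contDiffOn hU _ hg) h]
    refine Filter.EventuallyEq.iteratedDeriv_eq p ?_
    have hc : ContinuousAt (fun x' : ℝ => (x', y)) x := by fun_prop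
    filter_upwards [hc.preimage_mem_nhds (hU.mem_nhds h)] with x' hx'
    exact ((hg.differentiableAt_of_isOpen hU hx').hasFDerivAt.comp_hasDerivAt x'
      ((hasDerivAt_id x').prodMk (hasDerivAt_const x' y))).deriv

theorem iteratedDeriv_snd {U : Set (ℝ × ℝ)} (hU : IsOpen U) {g : ℝ × ℝ → ℝ}
    (hg : ContDiffOn ℝ (⊤ : ℕ∞) g U) (r : ℕ) {x y : ℝ} (h : (x, y) ∈ U) :
    iteratedDeriv r (fun y' => g (x, y')) y = (dirDeriv (0, 1))^[r] g (x, y) := by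
  induction r generalizing g y with
  | zero => simp
  | succ r ih =>
    rw [iteratedDeriv_succ', Function.iterate_succ_apply, ← ih (dirDeriv_contDiffOn hU _ hg) h]
    refine Filter.EventuallyEq.iteratedDeriv_eq r ?_
    have hc : ContinuousAt (fun y' : ℝ => (x, y')) y := by fun_prop
    filter_upwards [hc.preimage_mem_nhds (hU.mem_nhds h)] with y' hy'
    exact ((hg.differentiableAt_of_isOpen hU hy').hasFDerivAt.comp_hasDerivAt y'
      ((hasDerivAt_const y' x).prodMk (hasDerivAt_id y'))).deriv

theorem pd_eq_mixedDeriv {U : Set (ℝ × ℝ)} (hU : IsOpen U) {f : ℝ → ℝ → ℝ}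
    (hf : ContDiffOn ℝ (⊤ : ℕ∞) (Function.uncurry f) U) (p r : ℕ) {x y : ℝ} (h : (x, y) ∈ U) :
    pd f p r x y = mixedDeriv p r (Function.uncurry f) (x, y) := by
  rw [mixedDeriv, ← iteratedDeriv_fst hU (dirDeriv_iterate_contDiffOn hU _ hf r) p h, pd]
  refine Filter.EventuallyEq.iteratedDeriv_eq p ?_
  have hc : ContinuousAt (fun x' : ℝ => (x', y)) x := by fun_prop
  filter_upwards [hc.preimage_mem_nhds (hU.mem_nhds h)] with x' hx'
  exact iteratedDeriv_snd hU hf r hx'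

theorem pd_sub {U : Set (ℝ × ℝ)} (hU : IsOpen U) {f g : ℝ → ℝ → ℝ}
    (hf : ContDiffOn ℝ (⊤ : ℕ∞) (Function.uncurry f) U)
    (hg : ContDiffOn ℝ (⊤ : ℕ∞) (Function.uncurry g) U) (p r : ℕ) {x y : ℝ} (h : (x, y) ∈ U) :
    pd (fun x y => f x y - g x y) p r x y = pd f p r x y - pd g p r x y := by
  have hfg : Function.uncurry (fun x y => f x y - g x y) =
      Function.uncurry f - Function.uncurry g := rfl
  rw [pd_eq_mixedDeriv hU (hfg ▸ hf.sub hg) p r h, pd_eq_mixedDeriv hU hf p r h,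
    pd_eq_mixedDeriv hU hg p r h, hfg, mixedDeriv,
    dirDeriv_iterate_congr hU _ (dirDeriv_iterate_sub hU _ hf hg r) p h,
    dirDeriv_iterate_sub hU _ (dirDeriv_iterate_contDiffOn hU _ hf r)
      (dirDeriv_iterate_contDiffOn hU _ hg r) p h]
  rfl

theorem iteratedDeriv_comp_curve_eq_zero {U : Set (ℝ × ℝ)} (hU : IsOpen U) {g : ℝ × ℝ → ℝ}
    (hg : ContDiffOn ℝ (⊤ : ℕ∞) g U) {y : ℝ → ℝ} {x₀ : ℝ}
    (hy : ∀ᶠ x in 𝓝 x₀, ContDiffAt ℝ (⊤ : ℕ∞) y x) (h₀ : (x₀, y x₀) ∈ U) (m : ℕ)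
    (hz : ∀ p r, p + r ≤ m → mixedDeriv p r g (x₀, y x₀) = 0) :
    iteratedDeriv m (fun x => g (x, y x)) x₀ = 0 := by
  induction m using Nat.strong_induction_on generalizing g with
  | _ m ih =>
  cases m with
  | zero => simpa [mixedDeriv] using hz 0 0 le_rfl
  | succ m =>
    have hyc : ContDiffAt ℝ (⊤ : ℕ∞) y x₀ := hy.self_of_nhds
    have hgx := dirDeriv_contDiffOn hU (1, 0) hg
    have hgy := dirDeriv_contDiffOn hU (0, 1) hg
    have hcurve : ContDiffAt ℝ (⊤ : ℕ∞) (fun x => (x, y x)) x₀ := contDiffAt_id.prodMk hyc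
    have hderiv : deriv (fun x => g (x, y x)) =ᶠ[𝓝 x₀]
        fun x => dirDeriv (1, 0) g (x, y x) + dirDeriv (0, 1) g (x, y x) * deriv y x := by
      filter_upwards [hy, hcurve.continuousAt.preimage_mem_nhds (hU.mem_nhds h₀)] with x hx hxU
      have hyd := (hx.differentiableAt (by simp)).hasDerivAt
      have hd := ((hg.differentiableAt_of_isOpen hU hxU).hasFDerivAt.comp_hasDerivAt x
        ((hasDerivAt_id x).prodMk hyd)).deriv
      refine Eq.trans hd ?_
      have hv : ((1 : ℝ), deriv y x) = (1, 0) + deriv y x • ((0 : ℝ), (1 : ℝ)) := by simp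
      rw [hv, map_add, map_smul, smul_eq_mul, mul_comm]
      rfl
    have hcomp : ∀ {h : ℝ × ℝ → ℝ}, ContDiffOn ℝ (⊤ : ℕ∞) h U →
        ContDiffAt ℝ (⊤ : ℕ∞) (fun x => h (x, y x)) x₀ := fun hh =>
      (hh.contDiffAt (hU.mem_nhds h₀)).comp x₀ hcurve
    have hy' : ContDiffAt ℝ (⊤ : ℕ∞) (deriv y) x₀ := by
      have := hyc.fderiv_right (m := ((⊤ : ℕ∞) : WithTop ℕ∞)) (by simp)
      exact this.clm_apply contDiffAt_const
    have hle : ((m : ℕ∞) : WithTop ℕ∞) ≤ ((⊤ : ℕ∞) : WithTop ℕ∞) := by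
      exact_mod_cast le_top
    have hxz : iteratedDeriv m (fun x => dirDeriv (1, 0) g (x, y x)) x₀ = 0 := by
      refine ih m (Nat.lt_succ_self m) hgx fun p r hpr => ?_
      have h1 := dirDeriv_iterate_congr hU (1, 0) (dirDeriv_iterate_comm hU (0, 1) (1, 0) hg r) p h₀
      exact h1.trans (hz (p + 1) r (by omega))
    have hyz : ∀ i ≤ m, iteratedDeriv i (fun x => dirDeriv (0, 1) g (x, y x)) x₀ = 0 :=
      fun i hi => ih i (Nat.lt_succ_of_le hi) hgy fun p r hpr => hz p (r + 1) (by omega)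
    rw [iteratedDeriv_succ', hderiv.iteratedDeriv_eq,
      iteratedDeriv_fun_add ((hcomp hgx).of_le hle) (((hcomp hgy).mul hy').of_le hle), hxz,
      iteratedDeriv_fun_mul ((hcomp hgy).of_le hle) (hy'.of_le hle), zero_add]
    refine Finset.sum_eq_zero fun i hi => ?_
    rw [hyz i (by simpa [Nat.lt_succ_iff] using hi)]
    simp

/-- The formal Taylor series of `h` at `x₀`. -/
noncomputable def taylorSeries (x₀ : ℝ) (h : ℝ → ℝ) : PowerSeries ℝ :=
  PowerSeries.mk fun n => iteratedDeriv n h x₀ / (n.factorial : ℝ)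

theorem ContDiffAt.of_infty {h : ℝ → ℝ} {x₀ : ℝ} (hh : ContDiffAt ℝ (⊤ : ℕ∞) h x₀) (n : ℕ) :
    ContDiffAt ℝ n h x₀ :=
  hh.of_le (by exact_mod_cast le_top)

theorem taylorSeries_mul {x₀ : ℝ} {g h : ℝ → ℝ} (hg : ContDiffAt ℝ (⊤ : ℕ∞) g x₀)
    (hh : ContDiffAt ℝ (⊤ : ℕ∞) h x₀) :
    taylorSeries x₀ (fun x => g x * h x) = taylorSeries x₀ g * taylorSeries x₀ h := by
  ext n
  rw [PowerSeries.coeff_mul, Finset.Nat.sum_antidiagonal_eq_sum_range_succ_mk]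
  simp only [taylorSeries, PowerSeries.coeff_mk]
  rw [iteratedDeriv_fun_mul (hg.of_infty n) (hh.of_infty n), Finset.sum_div]
  refine Finset.sum_congr rfl fun i hi => ?_
  have hi' : i ≤ n := by simpa [Nat.lt_succ_iff] using hi
  rw [Nat.cast_choose ℝ hi']
  have h1 := Nat.cast_ne_zero (R := ℝ).2 (Nat.factorial_ne_zero n)
  field_simp

theorem taylorSeries_const (x₀ a : ℝ) : taylorSeries x₀ (fun _ => a) = PowerSeries.C a := by
  ext n
  rw [taylorSeries, PowerSeries.coeff_mk, PowerSeries.coeff_C, iteratedDeriv_const]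
  split_ifs with h
  · simp [h]
  · simp

theorem taylorSeries_pow {x₀ : ℝ} {h : ℝ → ℝ} (hh : ContDiffAt ℝ (⊤ : ℕ∞) h x₀) (m : ℕ) :
    taylorSeries x₀ (fun x => h x ^ m) = taylorSeries x₀ h ^ m := by
  induction m with
  | zero => simpa using taylorSeries_const x₀ 1
  | succ m ih => simp only [pow_succ, taylorSeries_mul (hh.pow m) hh, ih]

theorem taylorSeries_sum {ι : Type*} {x₀ : ℝ} (T : Finset ι) {h : ι → ℝ → ℝ}
    (hh : ∀ i ∈ T, ContDiffAt ℝ (⊤ : ℕ∞) (h i) x₀) :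
    taylorSeries x₀ (fun x => ∑ i ∈ T, h i x) = ∑ i ∈ T, taylorSeries x₀ (h i) := by
  ext n
  rw [map_sum]
  simp only [taylorSeries, PowerSeries.coeff_mk]
  rw [iteratedDeriv_fun_sum fun i hi => (hh i hi).of_infty n, Finset.sum_div]

theorem iteratedDeriv_sub_pow (x₀ : ℝ) (p q : ℕ) :
    iteratedDeriv p (fun x => (x - x₀) ^ q) x₀ = if p = q then (q.factorial : ℝ) else 0 := by
  rw [iteratedDeriv_comp_sub_const p (fun x : ℝ => x ^ q) x₀]
  simpa using iteratedDeriv_fun_pow_zero (𝕜 := ℝ) (n := p) (m := q)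

theorem taylorSeries_sub_self (x₀ : ℝ) : taylorSeries x₀ (fun x => x - x₀) = PowerSeries.X := by
  ext n
  have := iteratedDeriv_sub_pow x₀ n 1
  simp only [pow_one] at this
  rw [taylorSeries, PowerSeries.coeff_mk, this, PowerSeries.coeff_X]
  split_ifs with h <;> simp [h]

theorem pd_polynomial (x₀ y₀ : ℝ) (a : ℕ × ℕ → ℝ) (T : Finset (ℕ × ℕ)) (p r : ℕ) :
    pd (fun x y => ∑ v ∈ T, a v * ((x - x₀) ^ v.1 * (y - y₀) ^ v.2)) p r x₀ y₀ =
      if (p, r) ∈ T then a (p, r) * ((p.factorial : ℝ) * (r.factorial : ℝ)) else 0 := by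
  have h1 : ∀ x : ℝ, iteratedDeriv r
      (fun y => ∑ v ∈ T, a v * ((x - x₀) ^ v.1 * (y - y₀) ^ v.2)) y₀ =
      ∑ v ∈ T, a v * ((if r = v.2 then (v.2.factorial : ℝ) else 0) * (x - x₀) ^ v.1) := by
    intro x
    rw [iteratedDeriv_fun_sum fun v _ => by fun_prop]
    refine Finset.sum_congr rfl fun v _ => ?_
    rw [iteratedDeriv_const_mul_field, iteratedDeriv_const_mul_field, iteratedDeriv_sub_pow]
    ring
  simp only [pd, h1]
  rw [iteratedDeriv_fun_sum fun v _ => by fun_prop]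
  have h2 : ∀ v ∈ T, iteratedDeriv p (fun x => a v *
      ((if r = v.2 then (v.2.factorial : ℝ) else 0) * (x - x₀) ^ v.1)) x₀ =
      if (p, r) = v then a (p, r) * ((p.factorial : ℝ) * (r.factorial : ℝ)) else 0 := by
    rintro ⟨i, j⟩ _
    rw [iteratedDeriv_const_mul_field, iteratedDeriv_const_mul_field, iteratedDeriv_sub_pow]
    simp only [Prod.mk.injEq]
    by_cases hp : p = i <;> by_cases hr : r = j <;> simp [hp, hr, mul_comm]
  rw [Finset.sum_congr rfl h2, Finset.sum_ite_eq]

/-- The Taylor series of an implicit function annihilates every Taylor polynomial of `f`, up to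
the order of the latter. -/
theorem coeff_sum_taylor_eq_zero {f : ℝ → ℝ → ℝ} {x₀ y₀ : ℝ} {y : ℝ → ℝ}
    (hf : ∀ᶠ p in 𝓝 (x₀, y₀), ContDiffAt ℝ (⊤ : ℕ∞) (Function.uncurry f) p)
    (hy : ∀ᶠ x in 𝓝 x₀, ContDiffAt ℝ (⊤ : ℕ∞) y x) (hy0 : y x₀ = y₀)
    (himp : ∀ᶠ x in 𝓝 x₀, f x (y x) = 0) {N : ℕ} {T : Finset (ℕ × ℕ)}
    (hT : ∀ p r, p + r ≤ N → (p, r) ∈ T) {m : ℕ} (hm : m ≤ N) :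
    PowerSeries.coeff m (∑ v ∈ T,
      PowerSeries.C (pd f v.1 v.2 x₀ y₀ / ((v.1.factorial : ℝ) * (v.2.factorial : ℝ))) *
        (PowerSeries.X ^ v.1 * taylorSeries x₀ (fun x => y x - y₀) ^ v.2)) = 0 := by
  set a : ℕ × ℕ → ℝ := fun v =>
    pd f v.1 v.2 x₀ y₀ / ((v.1.factorial : ℝ) * (v.2.factorial : ℝ)) with ha
  obtain ⟨U, hUsub, hU, hPU⟩ := mem_nhds_iff.1 hf
  have hfU : ContDiffOn ℝ (⊤ : ℕ∞) (Function.uncurry f) U :=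
    fun P hP => ContDiffAt.contDiffWithinAt (hUsub hP)
  set Q : ℝ → ℝ → ℝ := fun x y => ∑ v ∈ T, a v * ((x - x₀) ^ v.1 * (y - y₀) ^ v.2) with hQ
  have hQU : ContDiffOn ℝ (⊤ : ℕ∞) (Function.uncurry Q) U := by
    refine ContDiff.contDiffOn ?_
    simp only [hQ, Function.uncurry_def]
    fun_prop
  have hyc : ContDiffAt ℝ (⊤ : ℕ∞) (fun x => y x - y₀) x₀ :=
    hy.self_of_nhds.sub contDiffAt_const
  have hxc : ContDiffAt ℝ (⊤ : ℕ∞) (fun x : ℝ => x - x₀) x₀ := by fun_prop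
  have hseries : taylorSeries x₀ (fun x => Q x (y x)) = ∑ v ∈ T,
      PowerSeries.C (a v) *
        (PowerSeries.X ^ v.1 * taylorSeries x₀ (fun x => y x - y₀) ^ v.2) := by
    rw [taylorSeries_sum T fun v _ =>
      contDiffAt_const.mul ((hxc.pow v.1).mul (hyc.pow v.2))]
    refine Finset.sum_congr rfl fun v _ => ?_
    rw [taylorSeries_mul contDiffAt_const ((hxc.pow v.1).mul (hyc.pow v.2)), taylorSeries_const,
      taylorSeries_mul (hxc.pow v.1) (hyc.pow v.2), taylorSeries_pow hxc, taylorSeries_pow hyc,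
      taylorSeries_sub_self]
  have hrem : iteratedDeriv m (fun x => f x (y x) - Q x (y x)) x₀ = 0 := by
    refine iteratedDeriv_comp_curve_eq_zero hU
      (g := Function.uncurry fun x y => f x y - Q x y) (hfU.sub hQU) hy (hy0 ▸ hPU) m ?_
    intro p r hpr
    rw [hy0, ← pd_eq_mixedDeriv (f := fun x y => f x y - Q x y) hU (hfU.sub hQU) p r hPU,
      pd_sub hU hfU hQU p r hPU,
      pd_polynomial, if_pos (hT p r (hpr.trans hm)), ha]
    have h1 := Nat.cast_ne_zero (R := ℝ).2 (Nat.factorial_ne_zero p)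
    have h2 := Nat.cast_ne_zero (R := ℝ).2 (Nat.factorial_ne_zero r)
    field_simp
    ring
  have hcong : (fun x => f x (y x) - Q x (y x)) =ᶠ[𝓝 x₀] fun x => -Q x (y x) := by
    filter_upwards [himp] with x hx
    rw [hx, zero_sub]
  rw [hcong.iteratedDeriv_eq, iteratedDeriv_fun_neg, neg_eq_zero] at hrem
  rw [← hseries, taylorSeries, PowerSeries.coeff_mk, hrem, zero_div]

theorem coeff_taylorSeries_pow_succ {f : ℝ → ℝ → ℝ} {x₀ y₀ : ℝ} {y : ℝ → ℝ}
    (hf : ∀ᶠ p in 𝓝 (x₀, y₀), ContDiffAt ℝ (⊤ : ℕ∞) (Function.uncurry f) p)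
    (hf0 : f x₀ y₀ = 0) (hfy : pd f 0 1 x₀ y₀ ≠ 0)
    (hy : ∀ᶠ x in 𝓝 x₀, ContDiffAt ℝ (⊤ : ℕ∞) y x) (hy0 : y x₀ = y₀)
    (himp : ∀ᶠ x in 𝓝 x₀, f x (y x) = 0) {N : ℕ} {T : Finset (ℕ × ℕ)}
    (hT : ∀ p r, p + r ≤ N → (p, r) ∈ insert (0, 0) (insert (0, 1) T))
    (h00 : (0, 0) ∉ T) (h01 : (0, 1) ∉ T) (m n : ℕ) (hn : n ≤ N) :
    PowerSeries.coeff n (taylorSeries x₀ (fun x => y x - y₀) ^ (m + 1)) =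
      ∑ v ∈ T, if v.1 ≤ n then
        -(pd f v.1 v.2 x₀ y₀ / ((v.1.factorial : ℝ) * (v.2.factorial : ℝ))) / pd f 0 1 x₀ y₀ *
          PowerSeries.coeff (n - v.1) (taylorSeries x₀ (fun x => y x - y₀) ^ (m + v.2)) else 0 := by
  set Y := taylorSeries x₀ fun x => y x - y₀ with hY
  set a : ℕ × ℕ → ℝ := fun v =>
    pd f v.1 v.2 x₀ y₀ / ((v.1.factorial : ℝ) * (v.2.factorial : ℝ)) with ha
  have hdvd : (PowerSeries.X : PowerSeries ℝ) ^ (N + 1) ∣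
      ∑ v ∈ insert (0, 0) (insert (0, 1) T),
        PowerSeries.C (a v) * (PowerSeries.X ^ v.1 * Y ^ v.2) :=
    PowerSeries.X_pow_dvd_iff.2 fun d hd =>
      coeff_sum_taylor_eq_zero hf hy hy0 himp hT (Nat.lt_succ_iff.1 hd)
  have hzero := PowerSeries.X_pow_dvd_iff.1 (hdvd.mul_left (Y ^ m)) n (Nat.lt_succ_of_le hn)
  have ha00 : a (0, 0) = 0 := by simp [ha, pd, hf0]
  have ha01 : a (0, 1) = pd f 0 1 x₀ y₀ := by simp [ha]
  rw [Finset.sum_insert (by simp [h00]), Finset.sum_insert h01, ha00, ha01, map_zero, zero_mul,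
    zero_add, mul_add, map_add] at hzero
  have h1 : Y ^ m * (PowerSeries.C (pd f 0 1 x₀ y₀) *
      (PowerSeries.X ^ (0, 1).1 * Y ^ (0, 1).2)) =
      PowerSeries.C (pd f 0 1 x₀ y₀) * Y ^ (m + 1) := by
    simp only [pow_zero, one_mul, pow_succ]
    ring
  have h2 : PowerSeries.coeff n
      (Y ^ m * ∑ v ∈ T, PowerSeries.C (a v) * (PowerSeries.X ^ v.1 * Y ^ v.2)) =
      ∑ v ∈ T, if v.1 ≤ n then a v * PowerSeries.coeff (n - v.1) (Y ^ (m + v.2)) else 0 := by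
    rw [Finset.mul_sum, map_sum]
    refine Finset.sum_congr rfl fun v _ => ?_
    have : Y ^ m * (PowerSeries.C (a v) * (PowerSeries.X ^ v.1 * Y ^ v.2)) =
        PowerSeries.C (a v) * (PowerSeries.X ^ v.1 * Y ^ (m + v.2)) := by
      rw [pow_add]; ring
    rw [this, PowerSeries.coeff_C_mul, PowerSeries.coeff_X_pow_mul']
    split_ifs <;> simp
  rw [h1, h2, PowerSeries.coeff_C_mul] at hzero
  have h3 : (∑ v ∈ T, if v.1 ≤ n then
      -a v / pd f 0 1 x₀ y₀ * PowerSeries.coeff (n - v.1) (Y ^ (m + v.2)) else 0) =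
      -(∑ v ∈ T, if v.1 ≤ n then a v * PowerSeries.coeff (n - v.1) (Y ^ (m + v.2)) else 0) /
        pd f 0 1 x₀ y₀ := by
    rw [← Finset.sum_neg_distrib, Finset.sum_div]
    refine Finset.sum_congr rfl fun v _ => ?_
    split_ifs
    · ring
    · simp
  rw [h3, eq_div_iff hfy]
  linear_combination hzero

/-- The indices `(p, t)` that can occur in an element of `B_n`. -/
def indexBox (n : ℕ) : Finset (ℕ × ℕ) :=
  (Finset.range (n + 1) ×ˢ Finset.range (2 * n + 1)) \ {(0, 0), (0, 1)}

theorem mem_indexBox {n : ℕ} {v : ℕ × ℕ} :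
    v ∈ indexBox n ↔ (v.1 ≤ n ∧ v.2 ≤ 2 * n) ∧ v ≠ (0, 0) ∧ v ≠ (0, 1) := by
  simp [indexBox]

theorem iteratedDeriv_eq_sum_powCoeff {f : ℝ → ℝ → ℝ} {x₀ y₀ : ℝ} {y : ℝ → ℝ}
    (hf : ∀ᶠ p in 𝓝 (x₀, y₀), ContDiffAt ℝ (⊤ : ℕ∞) (Function.uncurry f) p)
    (hf0 : f x₀ y₀ = 0) (hfy : pd f 0 1 x₀ y₀ ≠ 0)
    (hy : ∀ᶠ x in 𝓝 x₀, ContDiffAt ℝ (⊤ : ℕ∞) y x) (hy0 : y x₀ = y₀)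
    (himp : ∀ᶠ x in 𝓝 x₀, f x (y x) = 0) {n : ℕ} (hn : 1 ≤ n) :
    iteratedDeriv n y x₀ = ∑ k ∈ Finset.Icc 1 (2 * n - 1),
      (n.factorial : ℝ) * ((k - 1).factorial : ℝ) * powCoeff (fun v =>
        -(pd f v.1 v.2 x₀ y₀ / ((v.1.factorial : ℝ) * (v.2.factorial : ℝ))) / pd f 0 1 x₀ y₀)
        (indexBox n) k 1 n := by
  set c : ℕ × ℕ → ℝ := fun v =>
    -(pd f v.1 v.2 x₀ y₀ / ((v.1.factorial : ℝ) * (v.2.factorial : ℝ))) / pd f 0 1 x₀ y₀ with hc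
  have hT : ∀ v ∈ indexBox n, 2 ≤ 2 * v.1 + v.2 := by
    rintro ⟨p, t⟩ hv
    rw [mem_indexBox] at hv
    simp only [ne_eq, Prod.mk.injEq] at hv ⊢
    omega
  have hYX : (PowerSeries.X : PowerSeries ℝ) ∣ taylorSeries x₀ fun x => y x - y₀ := by
    rw [PowerSeries.X_dvd_iff, ← PowerSeries.coeff_zero_eq_constantCoeff_apply]
    simp [taylorSeries, hy0]
  have key := eq_lagrangeCoeff c hT (N := n)
    (y := fun m n => PowerSeries.coeff n (taylorSeries x₀ (fun x => y x - y₀) ^ m))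
    (fun k => by simp [PowerSeries.coeff_one])
    (fun m k hk => PowerSeries.X_pow_dvd_iff.1 (pow_dvd_pow_of_dvd hYX m) k hk)
    (fun m k hk => coeff_taylorSeries_pow_succ hf hf0 hfy hy hy0 himp (N := n)
      (fun p r hpr => by
        simp only [Finset.mem_insert, mem_indexBox, Prod.mk.injEq, ne_eq]
        omega)
      (by simp [mem_indexBox]) (by simp [mem_indexBox]) m k hk) 1 n le_rfl
  have hcoeff : PowerSeries.coeff n (taylorSeries x₀ (fun x => y x - y₀) ^ 1) =
      iteratedDeriv n y x₀ / (n.factorial : ℝ) := by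
    rw [pow_one, taylorSeries, PowerSeries.coeff_mk,
      iteratedDeriv_fun_sub (hy.self_of_nhds.of_infty n) contDiffAt_const, iteratedDeriv_const,
      if_neg (by omega), sub_zero]
  have hfac := Nat.cast_ne_zero (R := ℝ).2 (Nat.factorial_ne_zero n)
  rw [hcoeff, lagrangeCoeff, powCoeff_eq_zero c hT (by omega), zero_add, div_eq_iff hfac] at key
  obtain ⟨K, hK⟩ : ∃ K, 2 * n = K + 1 := ⟨2 * n - 1, by omega⟩
  rw [key, hK, Finset.sum_range_succ, powCoeff_eq_zero c hT (by omega), mul_zero, add_zero,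
    Finset.sum_mul, Finset.range_eq_Ico, Nat.add_sub_cancel]
  have hIcc : Finset.Icc 1 K = Finset.Ico (0 + 1) (K + 1) := by
    ext; simp
  rw [hIcc, ← Finset.sum_Ico_add' _ 0 K 1]
  refine Finset.sum_congr rfl fun k _ => ?_
  rw [Nat.add_sub_cancel]
  push_cast
  ring

theorem multiTerm_eq_mul_multiTerm_one {ι : Type*} (b d : ι → ℝ) (e : ℝ) (s : ι →₀ ℕ) :
    multiTerm (fun v => -(b v / d v) / e) s =
      (-1) ^ (s.sum fun _ a => a) * (s.prod fun v a => b v ^ a) / (s.prod fun v a => d v ^ a) /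
        e ^ (s.sum fun _ a => a) * multiTerm (fun _ => 1) s := by
  simp only [multiTerm, Finsupp.prod, Finsupp.sum, ← Finset.prod_pow_eq_pow_sum,
    ← Finset.prod_mul_distrib, ← Finset.prod_div_distrib]
  refine Finset.prod_congr rfl fun v _ => ?_
  rw [div_pow, neg_pow, div_pow, one_pow]
  ring

theorem finsum_zmem_of_bmem {n k : ℕ} (hn : 2 ≤ n) {s : (ℕ × ℕ) →₀ ℕ} (hs : Bmem n s)
    (hk : (s.sum fun _ c => c) = k) :
    ((k - s (1, 0) - 1).factorial : ℝ) *
      (∑ᶠ q ∈ {q : (ℕ × ℕ × ℕ) →₀ ℕ | Zmem s (s (1, 0)) q},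
        q.prod fun v c => (v.2.1.choose v.2.2 : ℝ) ^ c / (c.factorial : ℝ)) =
      ((k - 1).factorial : ℝ) * multiTerm (fun _ => 1) s := by
  obtain ⟨h00, h01, hp, ht⟩ := hs
  set s₀ := s.erase (1, 0) with hs₀
  have hZ : ∀ q, Zmem s (s (1, 0)) q ↔ Zmem s₀ (s (1, 0)) q := by
    intro q
    refine and_congr_right fun _ => and_congr_left fun _ => forall₃_congr fun p t hpt => ?_
    rw [hs₀, Finsupp.erase_ne]
    simp only [ne_eq, Prod.mk.injEq]
    omega
  have hsupp : ∀ i ∈ s₀.support, 2 ≤ i.1 + i.2 := by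
    rintro ⟨p, t⟩ hi
    rw [hs₀, Finsupp.support_erase, Finset.mem_erase, Finsupp.mem_support_iff] at hi
    by_contra! hlt
    have : (p = 0 ∧ t = 0) ∨ (p = 0 ∧ t = 1) ∨ (p = 1 ∧ t = 0) := by
      simp only at hlt
      omega
    rcases this with ⟨rfl, rfl⟩ | ⟨rfl, rfl⟩ | ⟨rfl, rfl⟩
    · exact hi.2 h00
    · exact hi.2 h01
    · exact hi.1 rfl
  have hadd : ∀ ω : ℕ × ℕ → ℕ, (s.sum fun v a => ω v * a) =
      ω (1, 0) * s (1, 0) + s₀.sum fun v a => ω v * a := fun ω =>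
    (Finsupp.add_sum_erase' s (1, 0) (fun v a => ω v * a) (by simp)).symm
  have hp' := hadd Prod.fst
  have ht' := hadd Prod.snd
  have hk' := hadd fun _ => 1
  simp only [one_mul, zero_mul, zero_add] at hp' ht' hk'
  rw [hk] at hk' ht
  have hlt : s (1, 0) < k := by
    by_contra! hle
    have hz : s₀ = 0 := by
      have h0 : (s₀.sum fun _ a => a) = 0 := by omega
      ext v
      by_contra hv
      exact hv ((Finset.sum_eq_zero_iff.1 h0) v (Finsupp.mem_support_iff.2 hv))
    rw [hz, Finsupp.sum_zero_index] at hp' ht' hk'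
    omega
  simp only [hZ]
  rw [finsum_zmem hsupp, ← ht']
  have hmt : multiTerm (fun _ => 1) s =
      1 / ((s (1, 0)).factorial : ℝ) * multiTerm (fun _ => 1) s₀ := by
    rw [multiTerm, ← Finsupp.mul_prod_erase' s (1, 0) _ (by simp), one_pow]
    rfl
  have hτ : (s.sum fun v a => v.2 * a) = k - 1 := by omega
  have hchoose := Nat.choose_mul_factorial_mul_factorial (show s (1, 0) ≤ k - 1 by omega)
  rw [hτ, hmt, ← hchoose, show k - 1 - s (1, 0) = k - s (1, 0) - 1 by omega]
  have := Nat.cast_ne_zero (R := ℝ).2 (Nat.factorial_ne_zero (s (1, 0)))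
  push_cast
  field_simp

theorem bmem_iff_mem_finsuppAntidiag {n k : ℕ} (hk : k ≤ 2 * n) (s : (ℕ × ℕ) →₀ ℕ) :
    (Bmem n s ∧ (s.sum fun _ c => c) = k) ↔ s ∈ (indexBox n).finsuppAntidiag k ∧
      (s.sum fun v a => v.1 * a) = n ∧ (s.sum fun v a => v.2 * a) + 1 = k := by
  rw [Finset.mem_finsuppAntidiag]
  constructor
  · rintro ⟨⟨h00, h01, hp, ht⟩, hs⟩
    have hle : ∀ (ω : ℕ × ℕ → ℕ), ∀ v ∈ s.support, ω v ≤ s.sum fun v a => ω v * a :=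
      fun ω v hv => (Nat.le_mul_of_pos_right _ (Nat.pos_of_ne_zero
        (Finsupp.mem_support_iff.1 hv))).trans
          (Finset.single_le_sum (f := fun v => ω v * s v) (fun _ _ => Nat.zero_le _) hv)
    have hsub : s.support ⊆ indexBox n := by
      intro v hv
      have h1 := hle Prod.fst v hv
      have h2 := hle Prod.snd v hv
      refine mem_indexBox.2 ⟨⟨by omega, by omega⟩, ?_, ?_⟩
      · rintro rfl
        exact Finsupp.mem_support_iff.1 hv h00
      · rintro rfl
        exact Finsupp.mem_support_iff.1 hv h01
    refine ⟨⟨?_, hsub⟩, hp, ht.trans hs⟩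
    rw [← hs, Finsupp.sum_of_support_subset _ hsub _ (by simp)]
  · rintro ⟨⟨hs, hsub⟩, hp, ht⟩
    have hk' : (s.sum fun _ c => c) = k := by
      rw [← hs, Finsupp.sum_of_support_subset _ hsub _ (by simp)]
    refine ⟨⟨?_, ?_, hp, ht.trans hk'.symm⟩, hk'⟩ <;>
    · by_contra h
      have := mem_indexBox.1 (hsub (Finsupp.mem_support_iff.2 h))
      simp at this

theorem statement16 (f : ℝ → ℝ → ℝ) (x₀ y₀ : ℝ) (y : ℝ → ℝ)
    (hf : ∀ᶠ p in 𝓝 (x₀, y₀), ContDiffAt ℝ (⊤ : ℕ∞) (Function.uncurry f) p)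
    (hf0 : f x₀ y₀ = 0) (hfy : pd f 0 1 x₀ y₀ ≠ 0)
    (hy : ∀ᶠ x in 𝓝 x₀, ContDiffAt ℝ (⊤ : ℕ∞) y x)
    (hy0 : y x₀ = y₀)
    (himp : ∀ᶠ x in 𝓝 x₀, f x (y x) = 0)
    (n : ℕ) (hn : 2 ≤ n) :
    iteratedDeriv n y x₀ =
      ∑ k ∈ Finset.Icc 1 (2 * n - 1),
        ∑ᶠ s ∈ {s : (ℕ × ℕ) →₀ ℕ | Bmem n s ∧ (s.sum fun _ c => c) = k},
          ((-1 : ℝ) ^ k * (n.factorial : ℝ) * ((k - s (1, 0) - 1).factorial : ℝ) /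
              (s.prod fun p c => ((p.1.factorial : ℝ) * (p.2.factorial : ℝ)) ^ c)) *
            (∑ᶠ q ∈ {q : (ℕ × ℕ × ℕ) →₀ ℕ | Zmem s (s (1, 0)) q},
              q.prod fun v c => (v.2.1.choose v.2.2 : ℝ) ^ c / (c.factorial : ℝ)) *
            (s.prod fun p c => (pd f p.1 p.2 x₀ y₀) ^ c) /
            (pd f 0 1 x₀ y₀) ^ k := by
  rw [iteratedDeriv_eq_sum_powCoeff hf hf0 hfy hy hy0 himp (by omega)]
  refine Finset.sum_congr rfl fun k hk => ?_
  rw [Finset.mem_Icc] at hk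
  classical
  rw [powCoeff, Finset.mul_sum]
  simp only [mul_ite, mul_zero]
  rw [← Finset.sum_filter, ← finsum_mem_coe_finset]
  refine finsum_mem_congr ?_ fun s hs => ?_
  · ext s
    rw [Finset.mem_coe, Finset.mem_filter]
    exact (bmem_iff_mem_finsuppAntidiag (by omega) s).symm
  · obtain ⟨hB, hsk⟩ := hs
    have hZ := finsum_zmem_of_bmem hn hB hsk
    rw [multiTerm_eq_mul_multiTerm_one (fun v => pd f v.1 v.2 x₀ y₀)
      (fun v : ℕ × ℕ => (v.1.factorial : ℝ) * (v.2.factorial : ℝ)), hsk]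
    linear_combination (-((-1 : ℝ) ^ k * (n.factorial : ℝ) /
      (s.prod fun p c => ((p.1.factorial : ℝ) * (p.2.factorial : ℝ)) ^ c) *
        (s.prod fun p c => (pd f p.1 p.2 x₀ y₀) ^ c) / (pd f 0 1 x₀ y₀) ^ k)) * hZ
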